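/- Let α ∈ (0,2) and γ > 1, and let μ be the pushforward of ν_α under the map z ↦ (z, |z|^γ sgn z) from ℝ to ℝ². Then the cone condition fails at the direction e₂ = (0,1): for every θ ∈ (0,1) there exists ε > 0 such that μ({u ∈ ℝ² : u·e₂ ≥ θ|u|} ∩ {u : 0 < |u| < ε}) = 0. -/

import Mathlib

open MeasureTheory
open scoped RealInnerProductSpace

noncomputable section

/-- The symmetric α-stable Lévy measure on ℝ: density `|z|^(-1-α)` w.r.t. Lebesgue
measure (the density vanishes at `z = 0` by the convention `0 ^ (-1-α) = 0`). -/
def stableMeasure (α : ℝ) : Measure ℝ :=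
  volume.withDensity fun z => ENNReal.ofReal (|z| ^ (-(1 + α)))

/-- The pushforward of the α-stable Lévy measure under `z ↦ (z, |z|^γ sgn z) ∈ ℝ²`. -/
def curveMeasure (α γ : ℝ) : Measure (EuclideanSpace ℝ (Fin 2)) :=
  Measure.map
    (fun z : ℝ =>
      EuclideanSpace.single (0 : Fin 2) z +
        EuclideanSpace.single (1 : Fin 2) (|z| ^ γ * Real.sign z))
    (stableMeasure α)

theorem measurable_realSign : Measurable Real.sign := by
  unfold Real.sign
  exact Measurable.ite measurableSet_Iio measurable_const
    (Measurable.ite measurableSet_Ioi measurable_const measurable_const)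

theorem measurable_curve (γ : ℝ) :
    Measurable fun z : ℝ =>
      EuclideanSpace.single (0 : Fin 2) z +
        EuclideanSpace.single (1 : Fin 2) (|z| ^ γ * Real.sign z) := by
  have hsingle (i : Fin 2) : Measurable fun z : ℝ => EuclideanSpace.single i z :=
    (Isometry.of_dist_eq (PiLp.dist_single_same 2 (fun _ : Fin 2 => ℝ) i)).continuous.measurable
  have hsnd : Measurable fun z : ℝ => |z| ^ γ * Real.sign z :=
    (measurable_id.abs.pow_const γ).mul measurable_realSign
  exact (hsingle 0).add ((hsingle 1).comp hsnd)

/-- Near the origin, the graph of `z ↦ |z|^γ sgn z` with `γ > 1` has slope less than `θ`. -/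
theorem abs_rpow_mul_sign_lt {γ θ z : ℝ} (hγ : 1 < γ) (hθ : 0 < θ) (hz : z ≠ 0)
    (hzθ : |z| < θ ^ (γ - 1)⁻¹) : |z| ^ γ * Real.sign z < θ * |z| := by
  have hz0 : 0 < |z| := abs_pos.mpr hz
  have hpow : |z| ^ (γ - 1) < θ :=
    (Real.lt_rpow_inv_iff_of_pos hz0.le hθ.le (sub_pos.mpr hγ)).mp hzθ
  calc |z| ^ γ * Real.sign z ≤ |z| ^ γ * 1 := by
        gcongr
        rcases Real.sign_apply_eq z with h | h | h <;> norm_num [h]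
    _ = |z| ^ (γ - 1) * |z| := by
        rw [Real.rpow_sub_one hz0.ne', div_mul_cancel₀ _ hz0.ne', mul_one]
    _ < θ * |z| := by gcongr

theorem statement_15 (α γ : ℝ) (hα : α ∈ Set.Ioo (0 : ℝ) 2) (hγ : 1 < γ) :
    ∀ θ ∈ Set.Ioo (0 : ℝ) 1, ∃ ε > (0 : ℝ),
      curveMeasure α γ
        ({u | θ * ‖u‖ ≤ ⟪u, EuclideanSpace.single (1 : Fin 2) (1 : ℝ)⟫} ∩
          {u | 0 < ‖u‖ ∧ ‖u‖ < ε}) = 0 := by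
  intro θ hθ
  refine ⟨θ ^ (γ - 1)⁻¹, Real.rpow_pos_of_pos hθ.1 _, ?_⟩
  have hmeas : MeasurableSet
      ({u : EuclideanSpace ℝ (Fin 2) |
          θ * ‖u‖ ≤ ⟪u, EuclideanSpace.single (1 : Fin 2) (1 : ℝ)⟫} ∩
        {u | 0 < ‖u‖ ∧ ‖u‖ < θ ^ (γ - 1)⁻¹}) := by
    refine (measurableSet_le (by fun_prop) (by fun_prop)).inter ?_
    exact (measurableSet_lt measurable_const measurable_norm).inter
      (measurableSet_lt measurable_norm measurable_const)
  rw [curveMeasure, Measure.map_apply (measurable_curve γ) hmeas]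
  convert measure_empty (μ := stableMeasure α)
  refine Set.eq_empty_of_forall_notMem fun z hz => ?_
  obtain ⟨hcone, hpos, hlt⟩ := hz
  set u := EuclideanSpace.single (0 : Fin 2) z +
    EuclideanSpace.single (1 : Fin 2) (|z| ^ γ * Real.sign z) with hu
  have hz0 : z ≠ 0 := by
    rintro rfl
    refine norm_pos_iff.mp hpos ?_
    ext i
    fin_cases i <;> simp
  have hzu : |z| ≤ ‖u‖ := by simpa [hu] using PiLp.norm_apply_le u 0
  have hinner : ⟪u, EuclideanSpace.single (1 : Fin 2) (1 : ℝ)⟫ = |z| ^ γ * Real.sign z := by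
    simp [hu, EuclideanSpace.inner_single_right]
  have hcone' : θ * ‖u‖ ≤ |z| ^ γ * Real.sign z := hinner ▸ hcone
  exact absurd (hcone'.trans_lt (abs_rpow_mul_sign_lt hγ hθ.1 hz0 (hzu.trans_lt hlt)))
    (not_lt.mpr (mul_le_mul_of_nonneg_left hzu hθ.1.le))
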